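/- Let H be a real p×n matrix with Ker(H) = {0} and B a real p×q matrix of full row rank; set Σ = B Bᵀ, H† = (Hᵀ H)⁻¹ Hᵀ, and (H Hᵀ)† = H (Hᵀ H)⁻¹ (Hᵀ H)⁻¹ Hᵀ. Fix ε > 0 and define C = ε (I_p − H H†) B with Moore–Penrose pseudoinverse C†, E = I_q − C† C, and D = ε E (I_q + ε² E Bᵀ (H Hᵀ)† B E)⁻¹ Bᵀ (H Hᵀ)† (I_p − ε B C†), where the indicated inverse exists because ε² E Bᵀ (H Hᵀ)† B E is symmetric positive semidefinite. Let z ∈ ℝ^p, and set x_wls = (Hᵀ Σ⁻¹ H)⁻¹ Hᵀ Σ⁻¹ z and x̂(ε) = (H† − ε H† B (C† + D)) z. Then x_wls − x̂(ε) = ε H† B D z. -/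

import Mathlib

open Matrix

/-- The four Moore–Penrose conditions characterizing the pseudoinverse `P` of `M`. -/
def IsPseudoinverse {m n : Type*} [Fintype m] [Fintype n]
    (M : Matrix m n ℝ) (P : Matrix n m ℝ) : Prop :=
  M * P * M = M ∧ P * M * P = P ∧ (M * P)ᵀ = M * P ∧ (P * M)ᵀ = P * M

/-- A pseudoinverse `P` of `M` annihilates on the right whatever `Mᵀ` annihilates. -/
theorem IsPseudoinverse.mul_eq_zero {m n k : Type*} [Fintype m] [Fintype n]
    {M : Matrix m n ℝ} {P : Matrix n m ℝ} (h : IsPseudoinverse M P) {A : Matrix m k ℝ}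
    (hA : Mᵀ * A = 0) : P * A = 0 := by
  obtain ⟨-, h₂, h₃, -⟩ := h
  calc P * A = P * (M * P)ᵀ * A := by rw [h₃, ← Matrix.mul_assoc, h₂]
    _ = P * Pᵀ * (Mᵀ * A) := by simp only [transpose_mul, Matrix.mul_assoc]
    _ = 0 := by rw [hA, Matrix.mul_zero]

theorem IsPseudoinverse.mul_mul_transpose {m n : Type*} [Fintype m] [Fintype n]
    {M : Matrix m n ℝ} {P : Matrix n m ℝ} (h : IsPseudoinverse M P) :
    P * M * Mᵀ = Mᵀ := by
  obtain ⟨h₁, -, -, h₄⟩ := h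
  rw [← h₄, ← transpose_mul, ← Matrix.mul_assoc, h₁]

/-- A left inverse `X` of `H` such that the rows of `X * S` lie in the row space of `Hᵀ` is the
weighted least squares operator with weight `S⁻¹`. -/
theorem eq_weighted_least_squares {m n : Type*} [Fintype m] [Fintype n] [DecidableEq m]
    [DecidableEq n] {H : Matrix m n ℝ} {S : Matrix m m ℝ} (hS : IsUnit S.det)
    {X : Matrix n m ℝ} {K : Matrix n n ℝ} (hXH : X * H = 1) (hXS : X * S = K * Hᵀ) :
    (Hᵀ * S⁻¹ * H)⁻¹ * Hᵀ * S⁻¹ = X := by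
  have hX : X = K * Hᵀ * S⁻¹ := by rw [← hXS, mul_nonsing_inv_cancel_right _ _ hS]
  have hK : K * (Hᵀ * S⁻¹ * H) = 1 := by rw [← hXH, hX]; simp only [Matrix.mul_assoc]
  rw [inv_eq_left_inv hK, hX]

/-- Corollary 3, approximation error:
`x_wls − x̂(ε) = ε H† B D z`. -/
theorem approximation_error {p n q : ℕ}
    (H : Matrix (Fin p) (Fin n) ℝ)
    (hH : ∀ x : Fin n → ℝ, H *ᵥ x = 0 → x = 0)
    (B : Matrix (Fin p) (Fin q) ℝ)
    (hB : LinearIndependent ℝ B)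
    (S : Matrix (Fin p) (Fin p) ℝ) (hS : S = B * Bᵀ)
    (Hd : Matrix (Fin n) (Fin p) ℝ) (hHd : Hd = (Hᵀ * H)⁻¹ * Hᵀ)
    (HHTd : Matrix (Fin p) (Fin p) ℝ)
    (hHHTd : HHTd = H * (Hᵀ * H)⁻¹ * (Hᵀ * H)⁻¹ * Hᵀ)
    (ε : ℝ) (hε : 0 < ε)
    (C : Matrix (Fin p) (Fin q) ℝ) (hC : C = ε • ((1 - H * Hd) * B))
    (Cd : Matrix (Fin q) (Fin p) ℝ) (hCd : IsPseudoinverse C Cd)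
    (E : Matrix (Fin q) (Fin q) ℝ) (hE : E = 1 - Cd * C)
    (D : Matrix (Fin q) (Fin p) ℝ)
    (hD : D = ε • (E * (1 + (ε ^ 2) • (E * Bᵀ * HHTd * B * E))⁻¹ * Bᵀ * HHTd *
      (1 - ε • (B * Cd))))
    (z : Fin p → ℝ)
    (xwls : Fin n → ℝ)
    (hxwls : xwls = ((Hᵀ * S⁻¹ * H)⁻¹ * Hᵀ * S⁻¹) *ᵥ z)
    (xhat : Fin n → ℝ)
    (hxhat : xhat = (Hd - ε • (Hd * B * (Cd + D))) *ᵥ z) :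
    xwls - xhat = ε • ((Hd * B * D) *ᵥ z) := by
  have hHH : IsUnit (Hᵀ * H).det := by
    have hinj : Function.Injective H.mulVec :=
      (injective_iff_map_eq_zero H.mulVecLin).2 hH
    have := (PosDef.conjTranspose_mul_self H hinj).isUnit
    rwa [conjTranspose_eq_transpose_of_trivial, isUnit_iff_isUnit_det] at this
  have hSu : IsUnit S.det := by
    have := (PosDef.mul_conjTranspose_self B (vecMul_injective_iff.2 hB)).isUnit
    rwa [conjTranspose_eq_transpose_of_trivial, isUnit_iff_isUnit_det, ← hS] at this
  have hHdH : Hd * H = 1 := by rw [hHd, Matrix.mul_assoc, nonsing_inv_mul _ hHH]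
  have hsymm : (H * Hd)ᵀ = H * Hd := by
    simp [hHd, transpose_nonsing_inv, Matrix.mul_assoc]
  have hCt : Cᵀ = ε • (Bᵀ * (1 - H * Hd)) := by
    rw [hC, transpose_smul, transpose_mul, transpose_sub, transpose_one, hsymm]
  have hCtH : Cᵀ * H = 0 := by
    rw [hCt, Matrix.smul_mul, Matrix.mul_assoc, Matrix.sub_mul, Matrix.mul_assoc, hHdH]
    simp
  have hCdH : Cd * H = 0 := hCd.mul_eq_zero hCtH
  have hCdB : ε • (Cd * B) = Cd * C := by
    rw [hC, Matrix.mul_smul, Matrix.sub_mul, Matrix.mul_sub, Matrix.mul_assoc H,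
      ← Matrix.mul_assoc Cd H, hCdH]
    simp
  set X := Hd - ε • (Hd * B * Cd) with hX
  have hXH : X * H = 1 := by
    rw [hX, Matrix.sub_mul, Matrix.smul_mul, Matrix.mul_assoc _ Cd, hCdH, hHdH]
    simp
  have hXB : X * B = Hd * B * (1 - Cd * C) := by
    rw [hX, Matrix.sub_mul, Matrix.smul_mul, Matrix.mul_assoc _ Cd, ← Matrix.mul_smul, hCdB,
      Matrix.mul_sub, Matrix.mul_one]
  have hXN : X * S * (1 - H * Hd) = 0 := by
    have h : ε • (X * S * (1 - H * Hd)) = 0 := by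
      rw [hS, ← Matrix.mul_assoc, Matrix.mul_assoc (X * B), ← Matrix.mul_smul, ← hCt, hXB,
        Matrix.mul_assoc, Matrix.sub_mul, hCd.mul_mul_transpose]
      simp
    exact (smul_eq_zero.1 h).resolve_left hε.ne'
  have hXS : X * S = X * S * Hdᵀ * Hᵀ := by
    rw [Matrix.mul_assoc _ Hdᵀ, ← transpose_mul, hsymm]
    rwa [Matrix.mul_sub, Matrix.mul_one, sub_eq_zero] at hXN
  rw [hxwls, hxhat, eq_weighted_least_squares hSu hXH hXS, ← sub_mulVec, ← smul_mulVec, hX,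
    Matrix.mul_add, smul_add]
  congr 1
  abel
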